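/- Let d ≥ 2 and let f : I^d → ℝ^d be a homeomorphism onto its image which is α-Hölder continuous for some α with (d−1)/d < α ≤ 1. Then lim_{ε→0} L(B(∂f(I^d), ε)) = 0, where B(A, ε) denotes the open ε-neighbourhood of the set A and ∂f(I^d) is the topological boundary of f(I^d). -/

import Mathlib

open MeasureTheory Metric Set Filter

noncomputable section

/-- `ℝ^d` with the Euclidean norm. -/
abbrev Euc (d : ℕ) := EuclideanSpace ℝ (Fin d)

/-- The integer lattice `ℤ^d ⊆ ℝ^d`. -/
def intLattice (d : ℕ) : Set (Euc d) := {x | ∀ i, ∃ m : ℤ, x i = (m : ℝ)}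

/-- The unit cube `I^d = [0,1]^d ⊆ ℝ^d`. -/
def unitCube (d : ℕ) : Set (Euc d) := {x | ∀ i, x i ∈ Icc (0:ℝ) 1}

/-- `X` is a separated net in `ℝ^d`: it is `r`-separated and an `s`-net for some `r, s > 0`. -/
def IsSeparatedNet {d : ℕ} (X : Set (Euc d)) : Prop :=
  ∃ r s : ℝ, 0 < r ∧ 0 < s ∧
    (∀ x ∈ X, ∀ y ∈ X, x ≠ y → r ≤ dist x y) ∧
    ∀ z : Euc d, ∃ x ∈ X, dist z x ≤ s

/-- Membership of `ω : (0, a) → (0, ∞)` in the class `𝓜` of strictly increasing, concave,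
submultiplicative moduli of continuity with `ω(t) ≥ t` and `ω(t) → 0` as `t → 0⁺`;
here `ω` is represented as a total function `ℝ → ℝ`, only its values on `(0, a)` matter. -/
structure MemM (ω : ℝ → ℝ) (a : ℝ) : Prop where
  a_pos : 0 < a
  a_le_one : a ≤ 1
  mono : StrictMonoOn ω (Ioo 0 a)
  concave : ConcaveOn ℝ (Ioo 0 a) ω
  subm : ∀ s ∈ Ioo (0:ℝ) a, ∀ t ∈ Ioo (0:ℝ) a, ω (s * t) ≤ ω s * ω t
  pos : ∀ t ∈ Ioo (0:ℝ) a, 0 < ω t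
  le_omega : ∀ t ∈ Ioo (0:ℝ) a, t ≤ ω t
  tendsto_zero : Tendsto ω (nhdsWithin 0 (Ioi 0)) (nhds 0)

/-- `f` is a bi-`ω`-mapping on `A` (with `ω` a modulus defined on `(0, a)`): `f` is injective on
`A` and there is `K > 0` with `dist (f x) (f y) ≤ K ω (dist x y)` and
`dist x y ≤ K ω (dist (f x) (f y))`, the bounds being imposed only when the argument of `ω` lies
in `(0, a)`. -/
def IsBiOmegaMapOn {E F : Type*} [PseudoMetricSpace E] [PseudoMetricSpace F]
    (ω : ℝ → ℝ) (a : ℝ) (f : E → F) (A : Set E) : Prop :=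
  Set.InjOn f A ∧
  ∃ K : ℝ, 0 < K ∧
    (∀ x ∈ A, ∀ y ∈ A, 0 < dist x y → dist x y < a →
      dist (f x) (f y) ≤ K * ω (dist x y)) ∧
    (∀ x ∈ A, ∀ y ∈ A, 0 < dist (f x) (f y) → dist (f x) (f y) < a →
      dist x y ≤ K * ω (dist (f x) (f y)))

/-- A set `P` in a metric space is porous. -/
def IsPorous {E : Type*} [PseudoMetricSpace E] (P : Set E) : Prop :=
  ∀ x : E, ∃ ε₀ : ℝ, 0 < ε₀ ∧ ∃ α ∈ Ioo (0:ℝ) 1, ∀ ε ∈ Ioo (0:ℝ) ε₀,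
    ∃ y : E, dist y x ≤ ε ∧ ball y (α * ε) ∩ P = ∅

/-- A set is σ-porous if it is a countable union of porous sets. -/
def IsSigmaPorous {E : Type*} [PseudoMetricSpace E] (P : Set E) : Prop :=
  ∃ F : ℕ → Set E, (∀ n, IsPorous (F n)) ∧ P = ⋃ n, F n

/-- `f : X → ℝ^d` is a homogeneous `ω`-mapping with some constant `K > 0`, for a modulus `ω`
defined on `(0, a)`:  `‖f x₂ - f x₁‖ ≤ K R ω (‖x₂ - x₁‖ / R)` for all `R > 0` and
`x₁, x₂ ∈ X ∩ B(0, R)`, the bound being imposed only when the argument of `ω` lies in `(0,a)`. -/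
def IsHomogeneousOmegaMap {d : ℕ} (ω : ℝ → ℝ) (a : ℝ)
    (A : Set (Euc d)) (f : Euc d → Euc d) : Prop :=
  ∃ K : ℝ, 0 < K ∧ ∀ R : ℝ, 0 < R → ∀ x₁ ∈ A ∩ ball 0 R, ∀ x₂ ∈ A ∩ ball 0 R,
    0 < dist x₂ x₁ / R → dist x₂ x₁ / R < a →
      dist (f x₂) (f x₁) ≤ K * R * ω (dist x₂ x₁ / R)

/-- Two sets `X, Y ⊆ ℝ^d` are bi-`ω` equivalent: there is a bijection `f : X → Y` such that
both `f` and `f⁻¹` are homogeneous `ω`-mappings. -/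
def BiOmegaEquiv {d : ℕ} (ω : ℝ → ℝ) (a : ℝ) (X Y : Set (Euc d)) : Prop :=
  ∃ f g : Euc d → Euc d, Set.BijOn f X Y ∧ Set.InvOn g f X Y ∧
    IsHomogeneousOmegaMap ω a X f ∧ IsHomogeneousOmegaMap ω a Y g

open Polynomial in
theorem exists_finset_weights_eval_one (n : ℕ) {δ : ℝ} (hδ : 0 < δ) :
    ∃ (s : Finset ℝ) (w : ℝ → ℝ), (∀ t ∈ s, 0 < t ∧ t < δ) ∧
      ∀ p : ℝ[X], p.natDegree ≤ n → p.eval 1 = ∑ t ∈ s, w t * p.eval t := by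
  classical
  set s : Finset ℝ := (Finset.range (n + 1)).image fun i : ℕ => δ / (i + 2) with hs
  have hcard : s.card = n + 1 := by
    rw [hs, Finset.card_image_of_injective, Finset.card_range]
    intro i j hij
    have hi : (i : ℝ) + 2 ≠ 0 := by positivity
    have hj : (j : ℝ) + 2 ≠ 0 := by positivity
    simp only at hij
    rw [div_eq_div_iff hi hj] at hij
    have := mul_left_cancel₀ hδ.ne' hij
    exact_mod_cast (by linarith : (i : ℝ) = j)
  refine ⟨s, fun t => (Lagrange.basis s id t).eval 1, ?_, fun p hp => ?_⟩
  · intro t ht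
    obtain ⟨i, -, rfl⟩ := Finset.mem_image.1 ht
    have hi : (0 : ℝ) ≤ i := Nat.cast_nonneg i
    exact ⟨by positivity, div_lt_self hδ (by linarith)⟩
  · have hdeg : p.degree < s.card := by
      rw [hcard]
      exact lt_of_le_of_lt degree_le_natDegree (by exact_mod_cast Nat.lt_succ_of_le hp)
    conv_lhs => rw [Lagrange.eq_interpolate (v := id) (Set.injOn_id _) hdeg]
    simp [Lagrange.interpolate_apply, eval_finsetSum, mul_comm]

section FiniteDimensional

variable {E : Type*} [NormedAddCommGroup E] [InnerProductSpace ℝ E] [FiniteDimensional ℝ E]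

open Polynomial in
theorem exists_polynomial_eval_eq_det_one_add_smul (A : E →L[ℝ] E) :
    ∃ p : ℝ[X], p.natDegree ≤ Module.finrank ℝ E ∧ ∀ t : ℝ, p.eval t = (1 + t • A).det := by
  classical
  let b := Module.finBasis ℝ E
  set M := LinearMap.toMatrix b b (A : E →ₗ[ℝ] E) with hM
  refine ⟨((X : ℝ[X]) • M.map C + (1 : Matrix _ _ ℝ).map C).det, ?_, fun t => ?_⟩
  · simpa using natDegree_det_X_add_C_le M 1
  · have h : ((1 + t • A : E →L[ℝ] E)).det = (1 + t • M).det := by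
      rw [ContinuousLinearMap.det, ← LinearMap.det_toMatrix b]
      congr 1
      rw [hM, ← LinearMap.toMatrix_one b, ← map_smul, ← map_add]
      rfl
    rw [h, ← coe_evalRingHom, RingHom.map_det]
    congr 1
    ext i j
    by_cases hij : i = j
    · subst hij
      simp only [coe_evalRingHom, RingHom.mapMatrix_apply, Matrix.map_apply, Matrix.add_apply,
        Matrix.smul_apply, smul_eq_mul, Matrix.one_apply_eq, eval_add, eval_mul, eval_X, eval_C]
      ring
    · simp only [coe_evalRingHom, RingHom.mapMatrix_apply, Matrix.map_apply, Matrix.add_apply,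
        Matrix.smul_apply, smul_eq_mul, Matrix.one_apply_ne hij, eval_add, eval_mul, eval_X, eval_C]
      ring

omit [FiniteDimensional ℝ E] in
theorem exists_det_one_add_pos : ∃ δ > 0, ∀ B : E →L[ℝ] E, ‖B‖ < δ → 0 < (1 + B).det := by
  have hc : Continuous fun B : E →L[ℝ] E => (1 + B).det :=
    ContinuousLinearMap.continuous_det.comp (continuous_const.add continuous_id)
  have h : ∀ᶠ B in nhds (0 : E →L[ℝ] E), 0 < (1 + B).det := by
    refine hc.continuousAt.eventually (lt_mem_nhds ?_)
    simp [ContinuousLinearMap.det]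
  obtain ⟨δ, hδ, hB⟩ := Metric.eventually_nhds_iff.1 h
  exact ⟨δ, hδ, fun B hBδ => hB (by simpa using hBδ)⟩

theorem det_eq_zero_of_norm_eventuallyEq {r : E → E} {x : E} {R : ℝ} (hR : 0 < R)
    (hr : DifferentiableAt ℝ r x) (h : ∀ᶠ y in nhds x, ‖r y‖ = R) :
    (fderiv ℝ r x).det = 0 := by
  have hd : HasFDerivAt (fun y => inner ℝ (r y) (r y)) (0 : E →L[ℝ] ℝ) x := by
    refine (hasFDerivAt_const (R ^ 2) x).congr_of_eventuallyEq ?_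
    filter_upwards [h] with y hy
    rw [real_inner_self_eq_norm_sq, hy]
  have horth : ∀ v, inner ℝ (r x) (fderiv ℝ r x v) = 0 := by
    intro v
    have := congrArg (fun L : E →L[ℝ] ℝ => L v)
      (hd.unique (hr.hasFDerivAt.inner ℝ hr.hasFDerivAt))
    simp [real_inner_comm] at this
    linarith [this, real_inner_comm (r x) (fderiv ℝ r x v)]
  by_contra hdet
  have hbij : Function.Surjective (fderiv ℝ r x) := by
    have hu : IsUnit (LinearMap.det (fderiv ℝ r x : E →ₗ[ℝ] E)) := isUnit_iff_ne_zero.2 hdet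
    exact (LinearEquiv.ofIsUnitDet (f := (fderiv ℝ r x : E →ₗ[ℝ] E)) (v := Module.finBasis ℝ E)
      (v' := Module.finBasis ℝ E) (by rwa [LinearMap.det_toMatrix])).surjective
  obtain ⟨v, hv⟩ := hbij (r x)
  have h0 := horth v
  rw [hv, real_inner_self_eq_norm_sq, h.self_of_nhds] at h0
  exact hR.ne' (pow_eq_zero_iff two_ne_zero |>.1 h0)

omit [FiniteDimensional ℝ E] in
theorem lipschitzWith_of_lipschitzOnWith_closedBall {g : E → E} {R : ℝ} {K : NNReal}
    (hK : LipschitzOnWith K g (closedBall 0 R)) (h0 : ∀ x, R ≤ ‖x‖ → g x = 0) :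
    LipschitzWith K g := by
  have key : ∀ x y, ‖x‖ ≤ R → R < ‖y‖ → dist (g x) (g y) ≤ K * dist x y := by
    intro x y hx hy
    have hc : ContinuousOn (fun t : ℝ => ‖AffineMap.lineMap x y t‖) (Icc (0:ℝ) 1) := by
      fun_prop
    obtain ⟨t, ht, htR⟩ := intermediate_value_Icc zero_le_one hc
      (show R ∈ Icc _ _ by simpa using ⟨hx, hy.le⟩)
    simp only at htR
    rw [h0 y hy.le, ← h0 _ htR.ge]
    refine (hK.dist_le_mul x (by simpa using hx) _ (by simpa using htR.le)).trans ?_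
    rw [dist_left_lineMap, Real.norm_of_nonneg ht.1]
    gcongr
    exact mul_le_of_le_one_left dist_nonneg ht.2
  refine LipschitzWith.of_dist_le_mul fun x y => ?_
  rcases le_or_gt ‖x‖ R with hx | hx <;> rcases le_or_gt ‖y‖ R with hy | hy
  · exact hK.dist_le_mul x (by simpa using hx) y (by simpa using hy)
  · exact key x y hx hy
  · rw [dist_comm, dist_comm x]; exact key y x hy hx
  · rw [h0 x hx.le, h0 y hy.le, dist_self]; positivity

theorem bijective_add_smul_of_lipschitzWith {g : E → E} {K : NNReal} (hK : LipschitzWith K g)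
    {t : ℝ} (ht : 0 ≤ t) (htK : t * K < 1) : Function.Bijective fun x => x + t • g x := by
  have hA : ApproximatesLinearOn (fun x => x + t • g x)
      ((ContinuousLinearEquiv.refl ℝ E : E ≃L[ℝ] E) : E →L[ℝ] E) univ (t.toNNReal * K) := by
    rw [ApproximatesLinearOn.approximatesLinearOn_iff_lipschitzOnWith, lipschitzOnWith_univ]
    refine LipschitzWith.of_dist_le_mul fun x y => ?_
    have : ∀ z, ((fun x => x + t • g x) -
      (((ContinuousLinearEquiv.refl ℝ E : E ≃L[ℝ] E) : E →L[ℝ] E) : E → E)) z = t • g z := by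
      intro z; simp
    rw [this, this, dist_smul₀, Real.norm_of_nonneg ht, NNReal.coe_mul, Real.coe_toNNReal t ht,
      mul_assoc]
    gcongr
    exact hK.dist_le_mul x y
  have hc : Subsingleton E ∨ t.toNNReal * K <
      ‖(((ContinuousLinearEquiv.refl ℝ E).symm : E ≃L[ℝ] E) : E →L[ℝ] E)‖₊⁻¹ := by
    rcases subsingleton_or_nontrivial E with h | h
    · exact Or.inl h
    · right
      have : ‖(((ContinuousLinearEquiv.refl ℝ E).symm : E ≃L[ℝ] E) : E →L[ℝ] E)‖₊ = 1 := by
        have := ContinuousLinearMap.norm_id (𝕜 := ℝ) (E := E)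
        exact NNReal.eq this
      rw [this, inv_one, ← NNReal.coe_lt_coe]
      simpa [Real.coe_toNNReal t ht] using htK
  exact ⟨injOn_univ.1 (hA.injOn hc), hA.surjective hc⟩

section Measure

variable [MeasurableSpace E] [BorelSpace E]

theorem setIntegral_det_one_add_smul_of_small {g : E → E} {g' : E → E →L[ℝ] E} {R : ℝ}
    {K : NNReal} (hK : LipschitzWith K g) (h0 : ∀ x, R ≤ ‖x‖ → g x = 0)
    (hg : ∀ x ∈ ball (0 : E) R, HasFDerivAt g (g' x) x) (μ : Measure E) [μ.IsAddHaarMeasure]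
    {t : ℝ} (ht : 0 ≤ t) (htK : t * K < 1)
    (hdet : ∀ x ∈ ball (0 : E) R, 0 < (1 + t • g' x).det)
    (hint : IntegrableOn (fun x => (1 + t • g' x).det) (ball 0 R) μ) :
    ∫ x in ball 0 R, (1 + t • g' x).det ∂μ = μ.real (ball 0 R) := by
  set φ : E → E := fun x => x + t • g x with hφ
  have hbij : Function.Bijective φ := bijective_add_smul_of_lipschitzWith hK ht htK
  have hout : ∀ x, R ≤ ‖x‖ → φ x = x := fun x hx => by simp [hφ, h0 x hx]
  have himage : φ '' ball 0 R = ball 0 R := by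
    apply Subset.antisymm
    · rintro _ ⟨x, hx, rfl⟩
      by_contra hn
      have hn' : R ≤ ‖φ x‖ := by simpa using hn
      have := hbij.1 (hout _ hn')
      rw [this] at hn
      exact hn hx
    · intro y hy
      obtain ⟨x, rfl⟩ := hbij.2 y
      refine ⟨x, ?_, rfl⟩
      by_contra hn
      rw [hout x (by simpa using hn)] at hy
      exact hn hy
  have hder : ∀ x ∈ ball (0 : E) R, HasFDerivWithinAt φ (1 + t • g' x) (ball 0 R) x :=
    fun x hx => ((hasFDerivAt_id x).add ((hg x hx).const_smul t)).hasFDerivWithinAt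
  have hl := lintegral_abs_det_fderiv_eq_addHaar_image μ measurableSet_ball hder hbij.1.injOn
  rw [himage] at hl
  rw [integral_eq_lintegral_of_nonneg_ae _ hint.aestronglyMeasurable, measureReal_def, ← hl]
  · congr 1
    refine setLIntegral_congr_fun measurableSet_ball fun x hx => ?_
    rw [abs_of_pos (hdet x hx)]
  · exact (ae_restrict_iff' measurableSet_ball).2 (ae_of_all _ fun x hx => (hdet x hx).le)

theorem setIntegral_det_one_add {g : E → E} {g' : E → E →L[ℝ] E} {R : ℝ}
    {K : NNReal} (hK : LipschitzWith K g) (h0 : ∀ x, R ≤ ‖x‖ → g x = 0)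
    (hg : ∀ x ∈ ball (0 : E) R, HasFDerivAt g (g' x) x) (hg' : Continuous g')
    (μ : Measure E) [μ.IsAddHaarMeasure] :
    ∫ x in ball 0 R, (1 + g' x).det ∂μ = μ.real (ball 0 R) := by
  have hint : ∀ t : ℝ, IntegrableOn (fun x => (1 + t • g' x).det) (ball 0 R) μ := by
    intro t
    have hc : Continuous fun x => (1 + t • g' x).det :=
      ContinuousLinearMap.continuous_det.comp (by fun_prop)
    exact (hc.continuousOn.integrableOn_compact (isCompact_closedBall 0 R)).mono_set
      ball_subset_closedBall
  obtain ⟨δ, hδ, hpos⟩ := exists_det_one_add_pos (E := E)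
  obtain ⟨M, hM⟩ := (isCompact_closedBall (0 : E) R).exists_bound_of_continuousOn
    hg'.continuousOn
  set N : ℝ := |M| + K + 1 with hN
  have hNpos : 0 < N := by positivity
  obtain ⟨s, w, hs, hw⟩ := exists_finset_weights_eval_one (Module.finrank ℝ E)
    (show 0 < min δ 1 / N by positivity)
  have hsmall : ∀ t ∈ s, ∫ x in ball 0 R, (1 + t • g' x).det ∂μ = μ.real (ball 0 R) := by
    intro t ht
    obtain ⟨ht0, htδ⟩ := hs t ht
    rw [lt_div_iff₀ hNpos] at htδ
    have hK0 : (0 : ℝ) ≤ K := K.2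
    refine setIntegral_det_one_add_smul_of_small hK h0 hg μ ht0.le ?_ ?_ (hint t)
    · have : t * K ≤ t * N := by gcongr; rw [hN]; linarith [abs_nonneg M]
      linarith [min_le_right δ 1]
    · intro x hx
      apply hpos
      rw [norm_smul, Real.norm_of_nonneg ht0.le]
      have h1 : ‖g' x‖ ≤ N := by
        have := hM x (ball_subset_closedBall hx)
        rw [hN]; linarith [le_abs_self M]
      have : t * ‖g' x‖ ≤ t * N := by gcongr
      linarith [min_le_left δ 1]
  have hsum : ∑ t ∈ s, w t = 1 := by simpa using (hw 1 (by simp)).symm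
  have hpt : ∀ x, (1 + g' x).det = ∑ t ∈ s, w t * (1 + t • g' x).det := by
    intro x
    obtain ⟨p, hp, hpe⟩ := exists_polynomial_eval_eq_det_one_add_smul (g' x)
    have := hw p hp
    simp only [hpe, one_smul] at this
    exact this
  simp_rw [hpt]
  rw [integral_finsetSum _ fun t _ => (hint t).const_mul (w t)]
  simp_rw [integral_const_mul]
  rw [Finset.sum_congr rfl fun t ht => by rw [hsmall t ht], ← Finset.sum_mul, hsum, one_mul]

/-- There is no `C^1` retraction of a closed ball onto its boundary sphere. -/
theorem not_exists_contDiff_retraction {r : E → E} {R : ℝ} (hR : 0 < R) (hr : ContDiff ℝ 1 r)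
    (hfix : ∀ x, ‖x‖ = R → r x = x) (hnorm : ∀ x ∈ ball (0 : E) R, ‖r x‖ = R) : False := by
  classical
  set μ : Measure E := Measure.addHaar
  set g : E → E := fun x => if ‖x‖ ≤ R then r x - x else 0 with hgdef
  have hg0 : ∀ x, R ≤ ‖x‖ → g x = 0 := by
    intro x hx
    by_cases h : ‖x‖ ≤ R
    · simp [hgdef, h, hfix x (le_antisymm h hx)]
    · simp [hgdef, h]
  have hsub : ContDiff ℝ 1 fun x => r x - x := hr.sub contDiff_id
  obtain ⟨K, hK⟩ := (hsub.locallyLipschitz.locallyLipschitzOn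
    (s := closedBall (0 : E) R)).exists_lipschitzOnWith_of_compact (isCompact_closedBall 0 R)
  have hgr : EqOn g (fun x => r x - x) (closedBall 0 R) := fun x hx => by
    simp only [hgdef]; rw [if_pos (by simpa using hx)]
  have hgL : LipschitzWith K g :=
    lipschitzWith_of_lipschitzOnWith_closedBall
      (fun x hx y hy => by rw [hgr hx, hgr hy]; exact hK hx hy) hg0
  have hder : ∀ x ∈ ball (0 : E) R, HasFDerivAt g (fderiv ℝ r x - 1) x := by
    intro x hx
    refine (((hr.differentiable one_ne_zero x).hasFDerivAt).sub
      (hasFDerivAt_id x)).congr_of_eventuallyEq ?_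
    filter_upwards [isOpen_ball.mem_nhds hx] with y hy
    exact hgr (ball_subset_closedBall hy)
  have hc : Continuous fun x => fderiv ℝ r x - 1 :=
    (hr.continuous_fderiv one_ne_zero).sub continuous_const
  have h1 := setIntegral_det_one_add hgL hg0 hder hc μ
  have h2 : ∫ x in ball 0 R, (1 + (fderiv ℝ r x - 1)).det ∂μ = 0 := by
    rw [setIntegral_congr_fun measurableSet_ball (g := fun _ => (0 : ℝ)), integral_zero]
    intro x hx
    simp only [add_sub_cancel]
    refine det_eq_zero_of_norm_eventuallyEq hR (hr.differentiable one_ne_zero x) ?_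
    filter_upwards [isOpen_ball.mem_nhds hx] with y hy using hnorm y hy
  rw [h2] at h1
  have hpos : 0 < μ.real (ball (0 : E) R) :=
    ENNReal.toReal_pos (measure_ball_pos μ 0 hR).ne' measure_ball_lt_top.ne
  exact hpos.ne h1

end Measure

theorem ContinuousOn.exists_continuous_extension {f : E → E} {s : Set E} (hs : IsClosed s)
    (hf : ContinuousOn f s) : ∃ F : E → E, Continuous F ∧ EqOn F f s := by
  have : TietzeExtension.{_, _} E := TietzeExtension.of_tvs ℝ
  obtain ⟨F, hF⟩ := ContinuousMap.exists_restrict_eq hs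
    (⟨s.domRestrict f, continuousOn_iff_continuous_domRestrict.1 hf⟩ : C(s, E))
  exact ⟨F, F.continuous, fun x hx => congrArg (fun φ : C(s, E) => φ ⟨x, hx⟩) hF⟩

omit [InnerProductSpace ℝ E] [FiniteDimensional ℝ E] in
theorem IsCompact.exists_pos_le_norm {s : Set E} (hs : IsCompact s) {f : E → E}
    (hf : ContinuousOn f s) (hne : ∀ x ∈ s, f x ≠ 0) : ∃ m > 0, ∀ x ∈ s, m ≤ ‖f x‖ := by
  rcases s.eq_empty_or_nonempty with rfl | hnon
  · exact ⟨1, one_pos, by simp⟩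
  · obtain ⟨x, hx, hmin⟩ := hs.exists_isMinOn hnon hf.norm
    exact ⟨‖f x‖, norm_pos_iff.2 (hne x hx), fun y hy => hmin hy⟩

theorem exists_zero_of_continuous_of_eq_id {u : E → E} {R : ℝ} (hR : 0 < R) (hu : Continuous u)
    (h0 : ∀ x, R ≤ ‖x‖ → u x = 0) : ∃ x ∈ closedBall (0 : E) R, x + u x = 0 := by
  borelize E
  by_contra! hne
  obtain ⟨m, hm, hmF⟩ := (isCompact_closedBall (0 : E) R).exists_pos_le_norm
    (f := fun x => x + u x) (by fun_prop) hne
  obtain ⟨v, hv, hvu, hsupp⟩ := hu.exists_contDiff_approx 1 (continuous_const (y := m))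
    fun _ => hm
  have hv0 : ∀ x, R ≤ ‖x‖ → v x = 0 := fun x hx => by
    by_contra hn
    exact hsupp hn (h0 x hx)
  have hF : ContDiff ℝ 1 fun x => x + v x := contDiff_id.add hv
  have hFne : ∀ x, x + v x ≠ 0 := by
    intro x hx
    rcases le_total R ‖x‖ with h | h
    · rw [hv0 x h, add_zero] at hx
      rw [hx, norm_zero] at h
      linarith
    · have h1 := hmF x (by simpa using h)
      have h2 := hvu x
      rw [dist_comm, dist_eq_norm, ← add_sub_add_left_eq_sub _ _ x, hx, sub_zero] at h2
      linarith
  refine not_exists_contDiff_retraction (r := fun x => (R / ‖x + v x‖) • (x + v x)) hR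
    ((contDiff_const.div (hF.norm ℝ hFne) fun x => norm_ne_zero_iff.2 (hFne x)).smul hF) ?_ ?_
  · intro x hx
    rw [hv0 x hx.ge, add_zero, hx, div_self hR.ne', one_smul]
  · intro x _
    rw [norm_smul, norm_div, norm_norm, Real.norm_of_nonneg hR.le,
      div_mul_cancel₀ _ (norm_ne_zero_iff.2 (hFne x))]

theorem exists_zero_of_norm_sub_le {H : E → E} {R : ℝ} (hR : 0 < R)
    (hH : ContinuousOn H (closedBall 0 R))
    (hclose : ∀ x ∈ closedBall (0 : E) R, ‖H x - x‖ ≤ R / 2) :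
    ∃ x ∈ closedBall (0 : E) R, H x = 0 := by
  obtain ⟨W, hW, hWH⟩ := hH.exists_continuous_extension isClosed_closedBall
  set χ : E → ℝ := fun x => max 0 (min 1 (4 - 4 * ‖x‖ / R)) with hχ
  have hχc : Continuous χ := by fun_prop
  have hχ0 : ∀ x, 0 ≤ χ x := fun x => le_max_left _ _
  have hχ1 : ∀ x, χ x ≤ 1 := fun x => max_le zero_le_one (min_le_left _ _)
  obtain ⟨x, hx, hx0⟩ := exists_zero_of_continuous_of_eq_id (u := fun x => χ x • (W x - x)) hR
    (by fun_prop) (by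
      intro x hx
      have : 4 - 4 * ‖x‖ / R ≤ 0 := by
        rw [sub_nonpos, le_div_iff₀ hR]; linarith
      simp only [hχ]
      rw [min_eq_right (by linarith), max_eq_left this, zero_smul])
  refine ⟨x, hx, ?_⟩
  have hxc := hclose x hx
  rw [← hWH hx] at hxc ⊢
  rcases le_or_gt ‖x‖ (3 / 4 * R) with h | h
  · have : 1 ≤ 4 - 4 * ‖x‖ / R := by
      rw [le_sub_comm, div_le_iff₀ hR]; linarith
    have h1 : χ x = 1 := by
      simp only [hχ]
      rw [min_eq_left this, max_eq_right zero_le_one]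
    simpa [h1] using hx0
  · exfalso
    have h1 : ‖x‖ = ‖χ x • (W x - x)‖ := by
      have h2 := congrArg norm (eq_neg_of_add_eq_zero_left hx0)
      rwa [norm_neg] at h2
    rw [norm_smul, Real.norm_of_nonneg (hχ0 x)] at h1
    have := mul_le_of_le_one_left (norm_nonneg (W x - x)) (hχ1 x)
    linarith

/-- Invariance of domain: a homeomorphism of a closed ball onto its image maps the centre of the
ball to an interior point of the image. -/
theorem mem_interior_image_closedBall {f g : E → E} {a : E} {R : ℝ} (hR : 0 < R)
    (hf : ContinuousOn f (closedBall a R)) (hg : ContinuousOn g (f '' closedBall a R))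
    (hgf : LeftInvOn g f (closedBall a R)) : f a ∈ interior (f '' closedBall a R) := by
  borelize E
  set K := f '' closedBall a R with hK
  have hKc : IsCompact K := (isCompact_closedBall a R).image_of_continuousOn hf
  have haR : a ∈ closedBall a R := mem_closedBall_self hR.le
  obtain ⟨G, hG, hGg⟩ := hg.exists_continuous_extension hKc.isClosed
  have hGf : ∀ x ∈ closedBall a R, G (f x) = x := fun x hx => by
    rw [hGg (mem_image_of_mem f hx), hgf hx]
  by_contra hint
  obtain ⟨η, hη, hGη⟩ := Metric.continuous_iff.1 hG (f a) (R / 16) (by positivity)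
  rw [hGf a haR] at hGη
  set ε := η / 2 with hε
  have hεpos : 0 < ε := half_pos hη
  obtain ⟨c, hc, hcK⟩ : ∃ c ∈ ball (f a) ε, c ∉ K := by
    by_contra! hsub
    exact hint (mem_interior_iff_mem_nhds.2 (mem_of_superset (ball_mem_nhds _ hεpos) hsub))
  rw [mem_ball] at hc
  have hGc : ∀ y ∈ closedBall c ε, ‖G y - a‖ < R / 16 := by
    intro y hy
    rw [← dist_eq_norm]
    refine hGη y ?_
    have := dist_triangle y c (f a)
    rw [mem_closedBall] at hy
    linarith
  obtain ⟨m, hm, hmG⟩ := (hKc.diff (isOpen_ball (x := c) (ε := ε))).exists_pos_le_norm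
    (f := fun y => G y - a) (by fun_prop) (by
      rintro _ ⟨⟨x, hx, rfl⟩, hxc⟩ h
      rw [hGf x hx, sub_eq_zero] at h
      rw [h, mem_ball, dist_comm] at hxc
      exact hxc hc)
  set δ := min m (R / 16) with hδ
  have hδpos : 0 < δ := by positivity
  obtain ⟨P, hP, hPG, -⟩ := hG.exists_contDiff_approx 1 (continuous_const (y := δ / 2))
    fun _ => half_pos hδpos
  have hnull : (Measure.addHaar : Measure E) (P '' sphere c ε) = 0 :=
    addHaar_image_eq_zero_of_differentiableOn_of_addHaar_eq_zero _
      (hP.differentiable one_ne_zero).differentiableOn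
      (Measure.addHaar_sphere_of_ne_zero _ _ hεpos.ne')
  obtain ⟨v, hva, hv⟩ : ∃ v ∈ ball a (δ / 2), v ∉ P '' sphere c ε := by
    by_contra! hsub
    exact (measure_ball_pos Measure.addHaar a (half_pos hδpos)).ne'
      (measure_mono_null hsub hnull)
  have hQ : ∀ y, ‖P y - v - (G y - a)‖ < δ := by
    intro y
    have h1 := hPG y
    have h2 : ‖v - a‖ < δ / 2 := by simpa [dist_eq_norm] using hva
    rw [dist_eq_norm] at h1
    have h3 : P y - v - (G y - a) = (P y - G y) - (v - a) := by abel
    rw [h3]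
    linarith [norm_sub_le (P y - G y) (v - a)]
  set Φ : E → E := fun y => c + max (ε / ‖y - c‖) 1 • (y - c) with hΦ
  have hΦc : ContinuousOn Φ K := by
    refine continuousOn_const.add (ContinuousOn.smul (ContinuousOn.sup
      (continuousOn_const.div (by fun_prop) fun y hy => ?_) continuousOn_const) (by fun_prop))
    rw [norm_ne_zero_iff, sub_ne_zero]
    rintro rfl
    exact hcK hy
  have hΦout : ∀ y, ε ≤ ‖y - c‖ → Φ y = y := by
    intro y hy
    simp only [hΦ]
    rw [max_eq_right ((div_le_one (hεpos.trans_le hy)).2 hy), one_smul, add_sub_cancel]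
  have hΦin : ∀ y ∈ K, ‖y - c‖ ≤ ε → Φ y ∈ sphere c ε := by
    intro y hyK hy
    have hpos : 0 < ‖y - c‖ := by
      rw [norm_pos_iff, sub_ne_zero]
      rintro rfl
      exact hcK hyK
    simp only [hΦ, mem_sphere, dist_eq_norm]
    rw [max_eq_left ((one_le_div hpos).2 hy), add_sub_cancel_left, norm_smul, norm_div, norm_norm,
      Real.norm_of_nonneg hεpos.le, div_mul_cancel₀ _ hpos.ne']
  have hmaps : MapsTo (fun x => a + x) (closedBall (0 : E) R) (closedBall a R) := by
    intro x hx
    simpa [dist_eq_norm] using hx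
  obtain ⟨x, hx, hx0⟩ := exists_zero_of_norm_sub_le (H := fun x => P (Φ (f (a + x))) - v) hR
    ((hP.continuous.comp_continuousOn (hΦc.comp (hf.comp (by fun_prop) hmaps)
      fun x hx => mem_image_of_mem f (hmaps hx))).sub continuousOn_const) (by
      intro x hx
      have hGx := hGf _ (hmaps hx)
      have hfx : f (a + x) ∈ K := mem_image_of_mem f (hmaps hx)
      simp only at hGx ⊢
      have h1 := hQ (Φ (f (a + x)))
      have hδR : δ ≤ R / 16 := min_le_right _ _
      rcases le_total ε ‖f (a + x) - c‖ with h | h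
      · rw [hΦout _ h] at h1 ⊢
        rw [hGx, add_sub_cancel_left] at h1
        linarith
      · have h2 := hGc _ (sphere_subset_closedBall (hΦin _ hfx h))
        have h3 := hGc (f (a + x)) (by simpa [dist_eq_norm] using h)
        rw [hGx, add_sub_cancel_left] at h3
        set z := Φ (f (a + x))
        have h4 : P z - v - x = (P z - v - (G z - a)) + (G z - a) - x := by abel
        rw [h4]
        have h5 := norm_sub_le ((P z - v - (G z - a)) + (G z - a)) x
        have h6 := norm_add_le (P z - v - (G z - a)) (G z - a)
        linarith)
  have hfx : f (a + x) ∈ K := mem_image_of_mem f (hmaps hx)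
  rcases le_or_gt ε ‖f (a + x) - c‖ with h | h
  · have h1 := hQ (f (a + x))
    have h2 := hmG (f (a + x)) ⟨hfx, by simpa [dist_eq_norm] using h⟩
    simp only [hΦout _ h] at hx0
    rw [hx0, zero_sub, norm_neg] at h1
    linarith [min_le_left m (R / 16)]
  · exact hv ⟨_, hΦin _ hfx h.le, sub_eq_zero.1 hx0⟩

end FiniteDimensional

theorem mem_interior_unitCube {d : ℕ} {x : Euc d} (hx : ∀ i, x i ∈ Ioo (0 : ℝ) 1) :
    x ∈ interior (unitCube d) := by
  have hopen : IsOpen {y : Euc d | ∀ i, y i ∈ Ioo (0 : ℝ) 1} := by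
    simp only [ofPred_forall]
    exact isOpen_iInter_of_finite fun i =>
      isOpen_Ioo.preimage (show Continuous fun y : Euc d => y i by fun_prop)
  exact interior_maximal (s := unitCube d) (t := {y : Euc d | ∀ i, y i ∈ Ioo (0 : ℝ) 1})
    (fun _ hy i => Ioo_subset_Icc_self (hy i)) hopen hx

theorem dimH_unitCube_diff_interior_le (n : ℕ) :
    dimH (unitCube (n + 1) \ interior (unitCube (n + 1))) ≤ n := by
  let φ : Fin (n + 1) × Bool → (Fin n → ℝ) → Euc (n + 1) := fun p z =>
    WithLp.toLp 2 (p.1.insertNth (α := fun _ => ℝ) (if p.2 then 1 else 0) z)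
  have hφ : ∀ p, ContDiff ℝ 1 (φ p) := by
    intro p
    rw [contDiff_euclidean]
    intro j
    refine Fin.succAboveCases p.1 ?_ (fun k => ?_) j
    · simpa [φ] using contDiff_const
    · simpa [φ] using contDiff_apply ℝ ℝ k
  have hsub : unitCube (n + 1) \ interior (unitCube (n + 1)) ⊆ ⋃ p, range (φ p) := by
    rintro x ⟨hx, hxi⟩
    obtain ⟨i, hi⟩ : ∃ i, x i ∉ Ioo (0 : ℝ) 1 := by
      by_contra! h
      exact hxi (mem_interior_unitCube h)
    have hend : x i = 0 ∨ x i = 1 := by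
      have h0 := (hx i).1
      have h1 := (hx i).2
      by_contra! h
      exact hi ⟨lt_of_le_of_ne h0 (Ne.symm h.1), lt_of_le_of_ne h1 h.2⟩
    refine mem_iUnion.2 ⟨(i, decide (x i = 1)), fun k => x (i.succAbove k), ?_⟩
    ext j
    refine Fin.succAboveCases i ?_ (fun k => ?_) j
    · rcases hend with h | h <;> simp [φ, h]
    · simp [φ]
  refine (dimH_mono hsub).trans ?_
  rw [dimH_iUnion]
  refine iSup_le fun p => (hφ p).dimH_range_le.trans ?_
  simp

theorem volume_eq_zero_of_dimH_lt {d : ℕ} {s : Set (Euc d)} (hs : dimH s < d) :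
    volume s = 0 := by
  have h : μH[((d : NNReal) : ℝ)] s = 0 := hausdorffMeasure_of_dimH_lt (by exact_mod_cast hs)
  rw [NNReal.coe_natCast] at h
  exact Measure.absolutelyContinuous_isAddHaarMeasure volume (μH[d] : Measure (Euc d)) h

theorem frontier_image_unitCube_subset {d : ℕ} {f g : Euc d → Euc d}
    (hf : ContinuousOn f (unitCube d)) (hg : LeftInvOn g f (unitCube d))
    (hgc : ContinuousOn g (f '' unitCube d)) (hcpt : IsCompact (unitCube d)) :
    frontier (f '' unitCube d) ⊆ f '' (unitCube d \ interior (unitCube d)) := by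
  intro y hy
  have hcl := (hcpt.image_of_continuousOn hf).isClosed
  obtain ⟨x, hx, rfl⟩ := hcl.frontier_subset hy
  refine ⟨x, ⟨hx, fun hxi => hy.2 ?_⟩, rfl⟩
  obtain ⟨R, hR, hRs⟩ := nhds_basis_closedBall.mem_iff.1 (mem_interior_iff_mem_nhds.1 hxi)
  exact interior_mono (image_mono hRs) (mem_interior_image_closedBall hR (hf.mono hRs)
    (hgc.mono (image_mono hRs)) (hg.mono hRs))

theorem isCompact_unitCube (d : ℕ) : IsCompact (unitCube d) := by
  have h : unitCube d = (EuclideanSpace.equiv (Fin d) ℝ) ⁻¹' (Icc 0 1) := by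
    ext x
    simp [unitCube, Pi.le_def, forall_and]
  rw [h]
  exact (EuclideanSpace.equiv (Fin d) ℝ).toHomeomorph.isCompact_preimage.2 isCompact_Icc

/-- Let `d ≥ 2` and let `f : I^d → ℝ^d` be a homeomorphism onto its image
(`f` is continuous and injective on `I^d`, with continuous inverse `g` on `f(I^d)`) which is
`α`-Hölder for some `(d-1)/d < α ≤ 1`. Then the Lebesgue measure of the open
`ε`-neighbourhood of `∂f(I^d)` tends to `0` as `ε → 0⁺`. -/
theorem statement_6 (d : ℕ) (hd : 2 ≤ d) (f g : Euc d → Euc d) (α C : ℝ)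
    (hα₁ : ((d : ℝ) - 1) / d < α) (hα₂ : α ≤ 1) (hC : 0 < C)
    (hf : ContinuousOn f (unitCube d)) (hinj : Set.InjOn f (unitCube d))
    (hg : Set.InvOn g f (unitCube d) (f '' unitCube d))
    (hgc : ContinuousOn g (f '' unitCube d))
    (hHolder : ∀ x ∈ unitCube d, ∀ y ∈ unitCube d, dist (f x) (f y) ≤ C * dist x y ^ α) :
    Tendsto (fun ε : ℝ => volume (Metric.thickening ε (frontier (f '' unitCube d))))
      (nhdsWithin 0 (Ioi 0)) (nhds 0) := by
  obtain ⟨n, rfl⟩ : ∃ n, d = n + 1 := ⟨d - 1, by omega⟩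
  have hn : (0 : ℝ) ≤ n := Nat.cast_nonneg n
  have hlt : (n : ℝ) < α * (n + 1) := by
    rw [div_lt_iff₀ (by positivity)] at hα₁
    push_cast at hα₁
    linarith
  have hα : 0 < α := pos_of_mul_pos_left (hn.trans_lt hlt) (by positivity)
  have hcpt := isCompact_unitCube (n + 1)
  have hhold : HolderOnWith C.toNNReal α.toNNReal f (unitCube (n + 1)) := by
    intro x hx y hy
    rw [edist_dist, edist_dist, Real.coe_toNNReal α hα.le,
      ENNReal.ofReal_rpow_of_nonneg dist_nonneg hα.le, ← ENNReal.ofReal,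
      ← ENNReal.ofReal_mul hC.le]
    exact ENNReal.ofReal_le_ofReal (hHolder x hx y hy)
  have hnull : volume (frontier (f '' unitCube (n + 1))) = 0 := by
    refine measure_mono_null (frontier_image_unitCube_subset hf hg.1 hgc hcpt)
      (volume_eq_zero_of_dimH_lt ?_)
    refine ((hhold.mono sdiff_subset).dimH_image_le (Real.toNNReal_pos.2 hα)).trans_lt ?_
    refine (ENNReal.div_le_div_right (dimH_unitCube_diff_interior_le n) _).trans_lt ?_
    rw [ENNReal.div_lt_iff (by simp [hα]) (by simp)]
    have : (n : NNReal) < ((n + 1 : ℕ) : NNReal) * α.toNNReal := by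
      rw [← NNReal.coe_lt_coe]
      push_cast
      rw [Real.coe_toNNReal α hα.le]
      linarith
    exact_mod_cast this
  have hbdd : Bornology.IsBounded (frontier (f '' unitCube (n + 1))) :=
    (hcpt.image_of_continuousOn hf).isBounded.subset
      (hcpt.image_of_continuousOn hf).isClosed.frontier_subset
  have h := tendsto_measure_thickening_of_isClosed (μ := volume)
    ⟨1, one_pos, (hbdd.thickening (δ := 1)).measure_lt_top.ne⟩
    (isClosed_frontier (s := f '' unitCube (n + 1)))
  rwa [hnull] at h
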